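/- Let K be a field and N ≥ 3. For every k with 2 ≤ k ≤ N−1, the matrix polynomial α_k belongs to Γ; that is, α_k satisfies P_0(x·α_k(x)) = P_0(α_k(0)·x), P_0(x^j·α_k(x)) = 0 for all j ≥ 2, and ∑_{l=0}^{q} (−1)^l S_N^{l+N−q−1} P_l(α_k) = 0 for every 0 ≤ q ≤ N−1. -/

import Mathlib

open Polynomial Finset

/-- The map P_k(θ) = (k+1)·θ_{k+1} − ∑_{j=k+2}^{k+D} (−1)^{j−k} [θ_j, S^{j−k−1}],
acting on matrix polynomials θ ∈ M_N(K[x]) (encoded as polynomials with N×N matrix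
coefficients), where S ∈ M_N(K) and [A,B] = AB − BA. -/
noncomputable def Pk {K : Type*} [Field K] {N : ℕ} (D : ℕ) (S : Matrix (Fin N) (Fin N) K)
    (k : ℕ) (θ : Polynomial (Matrix (Fin N) (Fin N) K)) : Matrix (Fin N) (Fin N) K :=
  (k + 1) • θ.coeff (k + 1) -
    ∑ j ∈ Finset.Icc (k + 2) (k + D),
      ((-1 : K) ^ (j - k)) • (θ.coeff j * S ^ (j - k - 1) - S ^ (j - k - 1) * θ.coeff j)

/-- The set Γ of matrix polynomials θ ∈ M_N(K[x]) satisfying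
(i) P_0(x·θ) = P_0(θ(0)·x), (ii) P_0(x^j·θ) = 0 for all j ≥ 2, and
(iii) ∑_{k=0}^{q} (−1)^k S^{k+D−q−1} P_k(θ) = 0 for every 0 ≤ q ≤ D−1. -/
noncomputable def GammaSet {K : Type*} [Field K] {N : ℕ} (D : ℕ)
    (S : Matrix (Fin N) (Fin N) K) : Set (Polynomial (Matrix (Fin N) (Fin N) K)) :=
  {θ | Pk D S 0 (X * θ) = Pk D S 0 (C (θ.coeff 0) * X) ∧
       (∀ j, 2 ≤ j → Pk D S 0 (X ^ j * θ) = 0) ∧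
       (∀ q, q < D →
         ∑ k ∈ Finset.range (q + 1),
           ((-1 : K) ^ k) • (S ^ (k + D - q - 1) * Pk D S k θ) = 0)}

/-- The 1-based matrix unit e_{r,s} ∈ M_N(K), with the convention that it is 0 when
r or s lies outside {1,…,N}. -/
def eu (K : Type*) [Field K] (N r s : ℕ) : Matrix (Fin N) (Fin N) K :=
  Matrix.of fun i j => if (i : ℕ) + 1 = r ∧ (j : ℕ) + 1 = s then 1 else 0

/-- The N×N shift matrix S_N = ∑_{s=1}^{N−1} e_{s,s+1}. -/
noncomputable def SN (K : Type*) [Field K] (N : ℕ) : Matrix (Fin N) (Fin N) K :=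
  ∑ s ∈ Finset.Icc 1 (N - 1), eu K N s (s + 1)

/-- The coefficient a_{kj} = (−1)^{j+1}(δ_{j,k−1} e_{k,1} + δ_{j,N−k} e_{N,k})
+ (−1)^j δ_{j,N−1} e_{N,1}. -/
noncomputable def acoef (K : Type*) [Field K] (N k j : ℕ) : Matrix (Fin N) (Fin N) K :=
  ((-1 : K) ^ (j + 1)) •
      ((if j = k - 1 then eu K N k 1 else 0) + (if j = N - k then eu K N N k else 0)) +
    ((-1 : K) ^ j) • (if j = N - 1 then eu K N N 1 else 0)

/-- The matrix polynomial α_k(x) = e_{k,k} + ∑_{j=1}^{N−1} a_{kj} x^j, for 2 ≤ k ≤ N−1. -/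
noncomputable def alphaPoly (K : Type*) [Field K] (N k : ℕ) :
    Polynomial (Matrix (Fin N) (Fin N) K) :=
  C (eu K N k k) + ∑ j ∈ Finset.Icc 1 (N - 1), C (acoef K N k j) * X ^ j

section PkGeneral

variable {K : Type*} [Field K] {N : ℕ} {D : ℕ} {S : Matrix (Fin N) (Fin N) K}

lemma Pk_add (l : ℕ) (θ η : Polynomial (Matrix (Fin N) (Fin N) K)) :
    Pk D S l (θ + η) = Pk D S l θ + Pk D S l η := by
  simp only [Pk, coeff_add, smul_add, add_mul, mul_add, add_sub_add_comm,
    Finset.sum_add_distrib]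

lemma Pk_neg (l : ℕ) (θ : Polynomial (Matrix (Fin N) (Fin N) K)) :
    Pk D S l (-θ) = -Pk D S l θ := by
  rw [eq_neg_iff_add_eq_zero, ← Pk_add, neg_add_cancel]
  simp [Pk]

lemma Pk_sub (l : ℕ) (θ η : Polynomial (Matrix (Fin N) (Fin N) K)) :
    Pk D S l (θ - η) = Pk D S l θ - Pk D S l η := by
  rw [sub_eq_add_neg, Pk_add, Pk_neg, sub_eq_add_neg]

lemma Pk_monomial_of_le {l i : ℕ} (h : i ≤ l) (A : Matrix (Fin N) (Fin N) K) :
    Pk D S l (monomial i A) = 0 := by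
  rw [Pk, coeff_monomial, if_neg (by omega), Finset.sum_eq_zero, smul_zero, sub_zero]
  intro j hj
  rw [Finset.mem_Icc] at hj
  rw [coeff_monomial, if_neg (by omega)]
  simp

lemma Pk_monomial_succ (l : ℕ) (A : Matrix (Fin N) (Fin N) K) :
    Pk D S l (monomial (l + 1) A) = (l + 1) • A := by
  rw [Pk, coeff_monomial, if_pos rfl, Finset.sum_eq_zero, sub_zero]
  intro j hj
  rw [Finset.mem_Icc] at hj
  rw [coeff_monomial, if_neg (by omega)]
  simp

lemma Pk_monomial_add_two (hS : S ^ D = 0) (l m : ℕ) (A : Matrix (Fin N) (Fin N) K) :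
    Pk D S l (monomial (l + m + 2) A) =
      (-1 : K) ^ (m + 1) • (A * S ^ (m + 1) - S ^ (m + 1) * A) := by
  rw [Pk, coeff_monomial, if_neg (by omega), smul_zero, zero_sub]
  by_cases hm : m + 2 ≤ D
  · rw [Finset.sum_eq_single_of_mem (l + m + 2) (Finset.mem_Icc.2 (by omega))]
    · rw [coeff_monomial, if_pos rfl, show l + m + 2 - l = m + 2 by omega,
        show m + 2 - 1 = m + 1 by rfl,
        ← neg_smul, pow_succ (-1 : K) (m + 1)]
      simp
    · intro j _ hj
      rw [coeff_monomial, if_neg (Ne.symm hj)]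
      simp
  · rw [pow_eq_zero_of_le (by omega) hS, Finset.sum_eq_zero]
    · simp
    · intro j hj
      rw [Finset.mem_Icc] at hj
      rw [coeff_monomial, if_neg (by omega)]
      simp

lemma alternating_sum_Pk_monomial (hS : S ^ D = 0) {q : ℕ} (hq : q < D) (i : ℕ)
    (A : Matrix (Fin N) (Fin N) K) :
    ∑ l ∈ Finset.range (q + 1),
        (-1 : K) ^ l • (S ^ (l + D - q - 1) * Pk D S l (monomial (i + 1) A)) =
      (-1 : K) ^ i • ∑ l ∈ Finset.range (i + 1), S ^ (l + (D - q - 1)) * A * S ^ (i - l) := by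
  obtain ⟨e, rfl⟩ : ∃ e, D = q + 1 + e := ⟨D - q - 1, by omega⟩
  simp only [show ∀ l, l + (q + 1 + e) - q - 1 = l + e by omega,
    show q + 1 + e - q - 1 = e by omega]
  have below : ∀ l < i, (-1 : K) ^ l • (S ^ (l + e) * Pk (q + 1 + e) S l (monomial (i + 1) A)) =
      (-1 : K) ^ i • (S ^ (l + e) * A * S ^ (i - l) - S ^ (i + e) * A) := by
    intro l hl
    obtain ⟨m, rfl⟩ := Nat.exists_eq_add_of_lt hl
    rw [show l + m + 1 + 1 = l + m + 2 by rfl, Pk_monomial_add_two hS,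
      show l + m + 1 - l = m + 1 by omega, mul_smul_comm, smul_smul, ← pow_add,
      mul_sub, ← mul_assoc, ← mul_assoc, ← pow_add,
      show l + e + (m + 1) = l + m + 1 + e by omega]
    rfl
  rcases le_or_gt i q with hiq | hiq
  · rw [← Finset.sum_subset (Finset.range_mono (show i + 1 ≤ q + 1 by omega)),
      Finset.sum_range_succ, Finset.sum_congr rfl fun l hl => below l (Finset.mem_range.1 hl),
      Pk_monomial_succ, ← Finset.smul_sum, ← smul_add, Finset.sum_sub_distrib,
      Finset.sum_range_succ _ i]
    · congr 1
      simp only [Finset.sum_const, Finset.card_range, Nat.sub_self, pow_zero, mul_one]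
      rw [mul_smul_comm]
      module
    · intro l _ hl
      rw [Finset.mem_range] at hl
      rw [Pk_monomial_of_le (by omega), mul_zero, smul_zero]
  · have hzero : S ^ (i + e) = 0 := pow_eq_zero_of_le (by omega) hS
    rw [← Finset.sum_subset (Finset.range_mono (show q + 1 ≤ i + 1 by omega)), Finset.smul_sum]
    · refine Finset.sum_congr rfl fun l hl => ?_
      rw [below l (by rw [Finset.mem_range] at hl; omega), hzero, zero_mul, sub_zero]
    · intro l _ hl
      rw [Finset.mem_range] at hl
      rw [pow_eq_zero_of_le (by omega) hS, zero_mul, zero_mul]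

end PkGeneral

section Shift

variable {K : Type*} [Field K] {N : ℕ}

lemma eu_zero_left (s : ℕ) : eu K N 0 s = 0 := by
  ext i j
  simp [eu]

lemma eu_of_lt_right (r : ℕ) {s : ℕ} (h : N < s) : eu K N r s = 0 := by
  ext i j
  have := j.isLt
  simp only [eu, Matrix.of_apply, Matrix.zero_apply]
  rw [if_neg (by omega)]

lemma SN_apply (i j : Fin N) : SN K N i j = if (j : ℕ) = i + 1 then 1 else 0 := by
  simp only [SN, Matrix.sum_apply, eu, Matrix.of_apply]
  split_ifs with h
  · rw [Finset.sum_eq_single_of_mem ((i : ℕ) + 1) (Finset.mem_Icc.2 (by omega))]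
    · rw [if_pos (by omega)]
    · intro s _ hs
      rw [if_neg (by omega)]
  · refine Finset.sum_eq_zero fun s _ => ?_
    rw [if_neg (by omega)]

lemma SN_pow_apply (m : ℕ) (i j : Fin N) :
    (SN K N ^ m) i j = if (j : ℕ) = i + m then 1 else 0 := by
  induction m generalizing j with
  | zero => simp [Matrix.one_apply, Fin.ext_iff, eq_comm]
  | succ m ih =>
    rw [pow_succ, Matrix.mul_apply]
    simp only [ih, SN_apply]
    split_ifs with h
    · rw [Finset.sum_eq_single_of_mem (⟨i + m, by omega⟩ : Fin N) (Finset.mem_univ _)]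
      · rw [if_pos rfl, if_pos (by simp only; omega), mul_one]
      · intro x _ hx
        rw [if_neg (fun h' => hx (Fin.ext h')), zero_mul]
    · refine Finset.sum_eq_zero fun x _ => ?_
      split_ifs <;> first | omega | simp

lemma SN_pow_self : SN K N ^ N = 0 := by
  ext i j
  rw [SN_pow_apply, if_neg (by omega), Matrix.zero_apply]

lemma SN_pow_mul_eu (m : ℕ) {r : ℕ} (hr : r ≤ N) (s : ℕ) :
    SN K N ^ m * eu K N r s = eu K N (r - m) s := by
  ext i j
  simp only [Matrix.mul_apply, SN_pow_apply, eu, Matrix.of_apply]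
  split_ifs with h
  · rw [Finset.sum_eq_single_of_mem (⟨i + m, by omega⟩ : Fin N) (Finset.mem_univ _)]
    · rw [if_pos rfl, if_pos (by simp only; omega), mul_one]
    · intro x _ hx
      rw [if_neg (fun h' => hx (Fin.ext h')), zero_mul]
  · refine Finset.sum_eq_zero fun x _ => ?_
    split_ifs <;> first | omega | simp

lemma eu_mul_SN_pow (m r : ℕ) {s : ℕ} (hs : 1 ≤ s) :
    eu K N r s * SN K N ^ m = eu K N r (s + m) := by
  ext i j
  simp only [Matrix.mul_apply, SN_pow_apply, eu, Matrix.of_apply]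
  split_ifs with h
  · rw [Finset.sum_eq_single_of_mem (⟨s - 1, by omega⟩ : Fin N) (Finset.mem_univ _)]
    · rw [if_pos (by simp only; omega), if_pos (by simp only; omega), mul_one]
    · intro x _ hx
      rw [if_neg (fun h' => hx (Fin.ext (by simp only; omega))), zero_mul]
  · refine Finset.sum_eq_zero fun x _ => ?_
    split_ifs <;> first | omega | simp

/-- The monomial `(-1)^i e_{i+s+1,s} x^{i+1}`. -/
noncomputable def euMonomial (K : Type*) [Field K] (N i s : ℕ) :
    Polynomial (Matrix (Fin N) (Fin N) K) :=
  monomial (i + 1) ((-1 : K) ^ i • eu K N (i + s + 1) s)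

lemma Pk_zero_X_pow_mul_C_eu {s : ℕ} (hs : 1 ≤ s) (hsN : s ≤ N) (j : ℕ) :
    Pk N (SN K N) 0 (X ^ (j + 2) * C (eu K N s s)) =
      (-1 : K) ^ (j + 1) • (eu K N s (s + j + 1) - eu K N (s - (j + 1)) s) := by
  have := Pk_monomial_add_two (SN_pow_self (K := K) (N := N)) 0 j (eu K N s s)
  rw [X_pow_mul_C, C_mul_X_pow_eq_monomial, show j + 2 = 0 + j + 2 by omega, this,
    eu_mul_SN_pow _ _ hs, SN_pow_mul_eu _ hsN]
  rfl

lemma Pk_zero_X_pow_mul_euMonomial {i s : ℕ} (hs : 1 ≤ s) (his : i + s + 1 ≤ N) (j : ℕ) :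
    Pk N (SN K N) 0 (X ^ (j + 1) * euMonomial K N i s) =
      (-1 : K) ^ (j + 1) • (eu K N (i + s + 1) (i + s + j + 1) - eu K N (s - j) s) := by
  have := Pk_monomial_add_two (SN_pow_self (K := K) (N := N)) 0 (i + j)
    ((-1 : K) ^ i • eu K N (i + s + 1) s)
  rw [euMonomial, X_pow_mul_monomial, show i + 1 + (j + 1) = 0 + (i + j) + 2 by omega, this,
    smul_mul_assoc, mul_smul_comm, ← smul_sub, smul_smul, ← pow_add,
    eu_mul_SN_pow _ _ hs, SN_pow_mul_eu _ his,
    show i + j + 1 + i = (j + 1) + 2 * i by omega, pow_add _ (j + 1), pow_mul]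
  simp only [neg_one_sq, one_pow, mul_one]
  congr 3 <;> omega

lemma alternating_sum_Pk_euMonomial {q : ℕ} (hq : q < N) {i s : ℕ} (hs : 1 ≤ s)
    (his : i + s + 1 ≤ N) :
    ∑ l ∈ Finset.range (q + 1),
        (-1 : K) ^ l • (SN K N ^ (l + N - q - 1) * Pk N (SN K N) l (euMonomial K N i s)) =
      ∑ c ∈ Finset.range (i + 1), eu K N (s + c + 1 - (N - q - 1)) (s + c) := by
  rw [euMonomial, alternating_sum_Pk_monomial SN_pow_self hq, ← Finset.sum_range_reflect,
    Finset.smul_sum]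
  refine Finset.sum_congr rfl fun c hc => ?_
  rw [Finset.mem_range] at hc
  rw [mul_smul_comm, smul_mul_assoc, smul_smul, ← pow_add, ← two_mul, pow_mul, neg_one_sq,
    one_pow, one_smul, SN_pow_mul_eu _ his, eu_mul_SN_pow _ _ hs]
  congr 1 <;> omega

lemma alphaPoly_eq (a b : ℕ) :
    alphaPoly K (a + b + 3) (a + 2) =
      C (eu K (a + b + 3) (a + 2) (a + 2)) + euMonomial K (a + b + 3) a 1 +
        euMonomial K (a + b + 3) b (a + 2) - euMonomial K (a + b + 3) (a + b + 1) 1 := by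
  have single : ∀ (m n : ℕ) (A : ℕ → Matrix (Fin (a + b + 3)) (Fin (a + b + 3)) K),
      m + 1 ≤ n → ∑ j ∈ Finset.Icc 1 n, monomial j (if j = m + 1 then A j else 0) =
        monomial (m + 1) (A (m + 1)) := by
    intro m n A hmn
    rw [Finset.sum_eq_single_of_mem (m + 1) (Finset.mem_Icc.2 (by omega)), if_pos rfl]
    intro j _ hj
    rw [if_neg hj, monomial_zero_right]
  simp only [alphaPoly, C_mul_X_pow_eq_monomial]
  simp only [acoef, smul_add, map_add, smul_ite, smul_zero, Finset.sum_add_distrib]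
  rw [show a + 2 - 1 = a + 1 by omega, show a + b + 3 - (a + 2) = b + 1 by omega,
    show a + b + 3 - 1 = a + b + 1 + 1 by omega, single a _ _ (by omega),
    single b _ _ (by omega), single (a + b + 1) _ _ le_rfl, ← add_assoc, ← add_assoc,
    sub_eq_add_neg]
  congr 2
  · congr 1
    simp [euMonomial, pow_succ]
  · rw [euMonomial, show b + (a + 2) + 1 = a + b + 3 by omega]
    simp [pow_succ]
  · rw [euMonomial, ← monomial_neg, ← neg_smul, pow_succ (-1 : K) (a + b + 1), mul_neg_one]

end Shift

/-- For N ≥ 3 and 2 ≤ k ≤ N−1, the matrix polynomial α_k belongs to Γ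
(with D = N and S = S_N the shift matrix). -/
theorem stmt_16 {K : Type*} [Field K] (N : ℕ) (hN : 3 ≤ N)
    (k : ℕ) (hk2 : 2 ≤ k) (hk : k ≤ N - 1) :
    alphaPoly K N k ∈ GammaSet N (SN K N) := by
  obtain ⟨a, rfl⟩ : ∃ a, k = a + 2 := ⟨k - 2, by omega⟩
  obtain ⟨b, rfl⟩ : ∃ b, N = a + b + 3 := ⟨N - (a + 3), by omega⟩
  rw [alphaPoly_eq]
  refine ⟨?_, ?_, ?_⟩
  · have hC (A : Matrix (Fin (a + b + 3)) (Fin (a + b + 3)) K) : X * C A = C A * X :=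
      X_mul_C A
    have hX (i s : ℕ) (hs : 1 ≤ s) (his : i + s + 1 ≤ a + b + 3) :=
      Pk_zero_X_pow_mul_euMonomial (K := K) hs his 0
    simp only [zero_add, pow_one, add_zero, Nat.sub_zero] at hX
    have h0 (i s : ℕ) : (euMonomial K (a + b + 3) i s).coeff 0 = 0 := by
      rw [euMonomial, coeff_monomial, if_neg (by omega)]
    rw [coeff_sub, coeff_add, coeff_add, h0, h0, h0, coeff_C_zero, add_zero, add_zero, sub_zero,
      mul_sub, mul_add, mul_add, Pk_sub, Pk_add, Pk_add, hC, hX _ _ le_rfl (by omega),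
      hX _ _ (by omega) (by omega), hX _ _ le_rfl (by omega),
      show a + 1 + 1 = a + 2 by omega, show b + (a + 2) + 1 = a + b + 3 by omega,
      show a + b + 1 + 1 + 1 = a + b + 3 by omega]
    module
  · intro j hj
    obtain ⟨j, rfl⟩ := Nat.exists_eq_add_of_le' hj
    have hX (i s : ℕ) (hs : 1 ≤ s) (his : i + s + 1 ≤ a + b + 3) :
        Pk (a + b + 3) (SN K (a + b + 3)) 0 (X ^ (j + 2) * euMonomial K (a + b + 3) i s) =
          -(-1 : K) ^ (j + 1) • (eu K (a + b + 3) (i + s + 1) (i + s + (j + 1) + 1) -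
            eu K (a + b + 3) (s - (j + 1)) s) := by
      rw [Pk_zero_X_pow_mul_euMonomial hs his (j + 1), pow_succ, mul_neg_one]
    rw [mul_sub, mul_add, mul_add, Pk_sub, Pk_add, Pk_add,
      Pk_zero_X_pow_mul_C_eu (by omega) (by omega), hX _ _ le_rfl (by omega),
      hX _ _ (by omega) (by omega), hX _ _ le_rfl (by omega),
      show 1 - (j + 1) = 0 by omega, eu_zero_left,
      eu_of_lt_right (b + (a + 2) + 1) (by omega), eu_of_lt_right (a + b + 1 + 1 + 1) (by omega),
      show a + 1 + 1 = a + 2 by omega, show a + 1 + (j + 1) + 1 = a + 2 + j + 1 by omega]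
    module
  · intro q hq
    have hC (l : ℕ) : Pk (a + b + 3) (SN K (a + b + 3)) l
        (C (eu K (a + b + 3) (a + 2) (a + 2))) = 0 := by
      rw [← monomial_zero_left, Pk_monomial_of_le (Nat.zero_le l)]
    simp only [Pk_sub, Pk_add, hC, zero_add, mul_sub, mul_add, smul_sub, smul_add,
      Finset.sum_sub_distrib, Finset.sum_add_distrib]
    rw [alternating_sum_Pk_euMonomial hq le_rfl (by omega),
      alternating_sum_Pk_euMonomial hq (by omega) (by omega),
      alternating_sum_Pk_euMonomial hq le_rfl (by omega),
      show a + b + 1 + 1 = (a + 1) + (b + 1) by omega, Finset.sum_range_add _ (a + 1), sub_eq_zero]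
    simp only [show ∀ c, 1 + (a + 1 + c) = a + 2 + c by omega]
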